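/- The equation x^3 - x y^2 + y^3 = 1 has exactly five integer solutions: (x,y) ∈ {(1,0), (0,1), (1,1), (-1,1), (4,-3)}. -/

import Mathlib

namespace Delone

abbrev Mat := Matrix (Fin 3) (Fin 3) ℤ

/-- Multiplication by `θ` (with `θ^3 = θ - 1`) in the basis `1, θ, θ^2`. -/
def A : Mat := !![0, 0, -1; 1, 0, 1; 0, 1, 0]
/-- Multiplication by the inverse of `θ`. -/
def B : Mat := !![1, 1, 0; 0, 0, 1; -1, 0, 0]

lemma A_mul_B : A * B = 1 := by decide
lemma B_mul_A : B * A = 1 := by decide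

def U : Matˣ := ⟨A, B, A_mul_B, B_mul_A⟩

lemma A_vec (v : Fin 3 → ℤ) : A.mulVec v = ![-v 2, v 0 + v 2, v 1] := by
  ext i; fin_cases i <;> simp [A, Matrix.mulVec, dotProduct, Fin.sum_univ_three]

lemma B_vec (v : Fin 3 → ℤ) : B.mulVec v = ![v 0 + v 1, v 2, -v 0] := by
  ext i; fin_cases i <;> simp [B, Matrix.mulVec, dotProduct, Fin.sum_univ_three]

/-- Norm form. -/
def N (v : Fin 3 → ℤ) : ℤ :=
  (v 0)^3 - (v 1)^3 + (v 2)^3 + 2*(v 0)^2*(v 2) - (v 0)*(v 1)^2 + (v 0)*(v 2)^2 + (v 1)*(v 2)^2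
    + 3*(v 0)*(v 1)*(v 2)

lemma N_A (v : Fin 3 → ℤ) : N (A.mulVec v) = - N v := by
  rw [A_vec]; simp [N]; ring

lemma N_B (v : Fin 3 → ℤ) : N (B.mulVec v) = - N v := by
  rw [B_vec]; simp [N]; ring

/-- Real embedding, `θ = -t`. -/
noncomputable def val (t : ℝ) (v : Fin 3 → ℤ) : ℝ := (v 0 : ℝ) - (v 1 : ℝ) * t + (v 2 : ℝ) * t^2

lemma val_A (t : ℝ) (ht : t^3 = t + 1) (v : Fin 3 → ℤ) : val t (A.mulVec v) = -t * val t v := by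
  rw [A_vec]; simp [val]; linear_combination (v 2 : ℝ) * ht

lemma val_B (t : ℝ) (ht : t^3 = t + 1) (ht0 : t ≠ 0) (v : Fin 3 → ℤ) :
    val t (B.mulVec v) = -t⁻¹ * val t v := by
  have h := val_A t ht (B.mulVec v)
  rw [Matrix.mulVec_mulVec, A_mul_B, Matrix.one_mulVec] at h
  rw [h]; field_simp

lemma zpow_vec (t : ℝ) (ht : t^3 = t + 1) (ht0 : 0 < t) (v : Fin 3 → ℤ) (n : ℤ) :
    |val t ((U^n : Matˣ).1.mulVec v)| = t^n * |val t v| ∧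
      |N ((U^n : Matˣ).1.mulVec v)| = |N v| := by
  induction n using Int.induction_on with
  | zero => simp
  | succ n ih =>
    have e : (U^((n:ℤ)+1) : Matˣ).1 = A * (U^(n:ℤ) : Matˣ).1 := by
      rw [zpow_add_one, (Commute.refl U).zpow_left n |>.eq]; rfl
    rw [e, ← Matrix.mulVec_mulVec, val_A t ht, N_A, abs_neg, abs_mul, ih.1, ih.2, abs_neg,
      abs_of_pos ht0, zpow_add_one₀ ht0.ne']
    exact ⟨by ring, rfl⟩
  | pred n ih =>
    have e : (U^(-(n:ℤ)-1) : Matˣ).1 = B * (U^(-(n:ℤ)) : Matˣ).1 := by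
      rw [zpow_sub_one, ((Commute.refl U).zpow_left (-n)).inv_right.eq]; rfl
    rw [e, ← Matrix.mulVec_mulVec, val_B t ht ht0.ne', N_B, abs_neg, abs_mul, ih.1, ih.2, abs_neg,
      abs_inv, abs_of_pos ht0, zpow_sub_one₀ ht0.ne']
    exact ⟨by ring, rfl⟩

def e0 : Fin 3 → ℤ := ![1, 0, 0]

/-- `v` is plus or minus a power of `θ`. -/
def P (v : Fin 3 → ℤ) : Prop :=
  ∃ n : ℤ, v = (U^n : Matˣ).1.mulVec e0 ∨ v = -((U^n : Matˣ).1.mulVec e0)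

lemma P_zpow {v : Fin 3 → ℤ} (h : P v) (m : ℤ) : P ((U^m : Matˣ).1.mulVec v) := by
  obtain ⟨n, h⟩ := h
  refine ⟨m + n, ?_⟩
  rw [zpow_add, Units.val_mul, ← Matrix.mulVec_mulVec]
  rcases h with h | h
  · left; rw [h]
  · right; rw [h, Matrix.mulVec_neg]

lemma P_neg {v : Fin 3 → ℤ} (h : P v) : P (-v) := by
  obtain ⟨n, h⟩ := h
  refine ⟨n, ?_⟩
  rcases h with h | h
  · right; rw [h]
  · left; rw [h, neg_neg]

lemma P_A {a b c : ℤ} (h : P ![a, b, c]) : P ![-c, a + c, b] := by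
  have := P_zpow h 1
  rw [zpow_one] at this
  change P (A.mulVec _) at this
  rw [A_vec] at this
  simpa using this

lemma P_B {a b c : ℤ} (h : P ![a, b, c]) : P ![a + b, c, -a] := by
  have := P_zpow h (-1)
  rw [zpow_neg_one] at this
  change P (B.mulVec _) at this
  rw [B_vec] at this
  simpa using this

lemma P_neg' {a b c : ℤ} (h : P ![-a, -b, -c]) : P ![a, b, c] := by
  have := P_neg h
  simpa using this

lemma box_list : ∀ a ∈ Finset.Icc (-3 : ℤ) 3, ∀ b ∈ Finset.Icc (-3 : ℤ) 3,
    ∀ c ∈ Finset.Icc (-1 : ℤ) 1, (N ![a, b, c] = 1 ∨ N ![a, b, c] = -1) →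
    (a, b, c) ∈ ([(-3, -1, 1), (-2, 0, 1), (-1, -2, -1), (-1, -1, 0), (-1, 0, 0), (-1, 0, 1),
      (-1, 1, -1), (-1, 1, 0), (-1, 1, 1), (-1, 2, -1), (0, -1, -1), (0, -1, 0), (0, -1, 1),
      (0, 0, -1), (0, 0, 1), (0, 1, -1), (0, 1, 0), (0, 1, 1), (1, -2, 1), (1, -1, -1),
      (1, -1, 0), (1, -1, 1), (1, 0, -1), (1, 0, 0), (1, 1, 0), (1, 2, 1), (2, 0, -1),
      (3, 1, -1)] : List (ℤ × ℤ × ℤ)) := by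
  decide +kernel

lemma box_P (a b c : ℤ) (ha : |a| ≤ 3) (hb : |b| ≤ 3) (hc : |c| ≤ 1)
    (h : N ![a, b, c] = 1 ∨ N ![a, b, c] = -1) : P ![a, b, c] := by
  rw [abs_le] at ha hb hc
  have key := box_list a (Finset.mem_Icc.2 ha) b (Finset.mem_Icc.2 hb) c (Finset.mem_Icc.2 hc) h
  have p0 : P ![1, 0, 0] := ⟨0, Or.inl (by simp [e0])⟩
  have p1 : P ![0, 1, 0] := by simpa using P_A p0
  have p2 : P ![0, 0, 1] := by simpa using P_A p1
  have p3 : P ![-1, 1, 0] := by simpa using P_A p2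
  have p4 : P ![0, -1, 1] := by simpa using P_A p3
  have p5 : P ![-1, 1, -1] := by simpa using P_A p4
  have p6 : P ![1, -2, 1] := by simpa using P_A p5
  have m1 : P ![1, 0, -1] := by simpa using P_B p0
  have m2 : P ![1, -1, -1] := by simpa using P_B m1
  have m3 : P ![0, -1, -1] := by simpa using P_B m2
  have m4 : P ![-1, -1, 0] := by simpa using P_B m3
  have m5 : P ![-2, 0, 1] := by simpa using P_B m4
  have m6 : P ![-2, 1, 2] := by simpa using P_B m5
  have m7 : P ![-1, 2, 2] := by simpa using P_B m6
  have m8 : P ![1, 2, 1] := by simpa using P_B m7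
  have m9 : P ![3, 1, -1] := by simpa using P_B m8
  simp only [List.mem_cons, Prod.mk.injEq, List.not_mem_nil, or_false] at key
  rcases key with ⟨rfl, rfl, rfl⟩ | ⟨rfl, rfl, rfl⟩ | ⟨rfl, rfl, rfl⟩ | ⟨rfl, rfl, rfl⟩ |
    ⟨rfl, rfl, rfl⟩ | ⟨rfl, rfl, rfl⟩ | ⟨rfl, rfl, rfl⟩ | ⟨rfl, rfl, rfl⟩ | ⟨rfl, rfl, rfl⟩ |
    ⟨rfl, rfl, rfl⟩ | ⟨rfl, rfl, rfl⟩ | ⟨rfl, rfl, rfl⟩ | ⟨rfl, rfl, rfl⟩ | ⟨rfl, rfl, rfl⟩ |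
    ⟨rfl, rfl, rfl⟩ | ⟨rfl, rfl, rfl⟩ | ⟨rfl, rfl, rfl⟩ | ⟨rfl, rfl, rfl⟩ | ⟨rfl, rfl, rfl⟩ |
    ⟨rfl, rfl, rfl⟩ | ⟨rfl, rfl, rfl⟩ | ⟨rfl, rfl, rfl⟩ | ⟨rfl, rfl, rfl⟩ | ⟨rfl, rfl, rfl⟩ |
    ⟨rfl, rfl, rfl⟩ | ⟨rfl, rfl, rfl⟩ | ⟨rfl, rfl, rfl⟩ | ⟨rfl, rfl, rfl⟩ <;>
  first
  | assumption
  | (apply P_neg'; simpa only [neg_neg, neg_zero] using ‹_›)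

set_option maxHeartbeats 1000000 in
lemma bounds (t : ℝ) (ht : t^3 = t + 1) (h1 : 1.32 ≤ t) (h2 : t ≤ 1.33) (a b c : ℤ)
    (hN : N ![a, b, c] = 1 ∨ N ![a, b, c] = -1) (hv1 : 1 ≤ |val t ![a, b, c]|)
    (hv2 : |val t ![a, b, c]| < t) : |a| ≤ 3 ∧ |b| ≤ 3 ∧ |c| ≤ 1 := by
  have hval : val t ![a, b, c] = a - b * t + c * t^2 := by simp [val]
  have hQ : ((N ![a, b, c] : ℤ) : ℝ) = val t ![a, b, c] *
      ((a + t*b/2 + (1 - t^2/2)*c)^2 + (3*t^2/4 - 1)*(b + c*t)^2) := by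
    have t4 : t^4 = t^2 + t := by linear_combination t * ht
    have t5 : t^5 = t^2 + t + 1 := by linear_combination (t^2 + 1) * ht
    have t6 : t^6 = t^2 + 2*t + 1 := by linear_combination (t^3 + t + 1) * ht
    rw [hval]; simp [N]; ring_nf
    simp only [ht, t4, t5, t6]; ring
  set V := val t ![a, b, c] with hV
  set R : ℝ := a + t*b/2 + (1 - t^2/2)*c with hR
  set D : ℝ := b + c*t with hD
  have hk : 0.3068 ≤ 3*t^2/4 - 1 := by nlinarith
  have hQ0 : 0 ≤ R^2 + (3*t^2/4 - 1)*D^2 := by positivity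
  have hQ1 : R^2 + (3*t^2/4 - 1)*D^2 ≤ 1 := by
    have : |((N ![a, b, c] : ℤ) : ℝ)| = 1 := by rcases hN with h | h <;> simp [h]
    rw [hQ, abs_mul, abs_of_nonneg hQ0] at this
    nlinarith
  have hR1 : |R| ≤ 1 := by
    rw [abs_le_one_iff_mul_self_le_one]; nlinarith [sq_nonneg D]
  have hD1 : |D| ≤ 1.81 := by
    apply abs_le_of_sq_le_sq _ (by norm_num)
    nlinarith [sq_nonneg R, sq_nonneg D]
  rw [abs_le] at hR1 hD1
  rw [abs_lt] at hv2
  have e1 : V - R = -1.5 * (t * D) + c * (3*t^2 - 1) := by rw [hval, hR, hD]; ring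
  have tD1 : t * D ≤ 2.41 := by nlinarith
  have tD2 : -2.41 ≤ t * D := by nlinarith
  have hg : 4.2 ≤ 3*t^2 - 1 := by linarith
  have hc1 : c < 2 := by
    by_contra hh
    have : (2:ℝ) ≤ c := by exact_mod_cast not_lt.1 hh
    have := mul_le_mul this hg (by norm_num) (by linarith)
    linarith
  have hc2 : -2 < c := by
    by_contra hh
    have : (2:ℝ) ≤ -c := by
      have : (c:ℝ) ≤ -2 := by exact_mod_cast not_lt.1 hh
      linarith
    have := mul_le_mul this hg (by norm_num) (by linarith)
    linarith
  have hc3 : (c:ℝ) ≤ 1 := by exact_mod_cast Int.lt_add_one_iff.1 hc1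
  have hc4 : (-1:ℝ) ≤ c := by exact_mod_cast hc2
  have hb1 : (b:ℝ) < 4 := by nlinarith
  have hb2 : (-4:ℝ) < b := by nlinarith
  have hb1' : b < 4 := by exact_mod_cast hb1
  have hb2' : -4 < b := by exact_mod_cast hb2
  have hb3 : (b:ℝ) ≤ 3 := by exact_mod_cast Int.lt_add_one_iff.1 hb1'
  have hb4 : (-3:ℝ) ≤ b := by exact_mod_cast hb2'
  have tb1 : t * b ≤ 3.99 := by nlinarith
  have tb2 : -3.99 ≤ t * b := by nlinarith
  have g1 : 0 ≤ 1 - t^2/2 := by nlinarith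
  have g2 : 1 - t^2/2 ≤ 0.2 := by nlinarith
  have tc1 : (1 - t^2/2) * c ≤ 0.2 := by nlinarith
  have tc2 : -0.2 ≤ (1 - t^2/2) * c := by nlinarith
  have ha1 : (a:ℝ) < 4 := by linarith
  have ha2 : (-4:ℝ) < a := by linarith
  have ha1' : a < 4 := by exact_mod_cast ha1
  have ha2' : -4 < a := by exact_mod_cast ha2
  refine ⟨abs_le.2 ⟨?_, ?_⟩, abs_le.2 ⟨?_, ?_⟩, abs_le.2 ⟨?_, ?_⟩⟩ <;> omega

lemma exists_t : ∃ t : ℝ, t^3 = t + 1 ∧ 1.32 ≤ t ∧ t ≤ 1.33 := by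
  have h := intermediate_value_Icc (a := (1.32:ℝ)) (b := 1.33) (by norm_num)
    (f := fun t : ℝ => t^3 - t) (by fun_prop)
  obtain ⟨t, ht, e⟩ := h (show (1:ℝ) ∈ _ by constructor <;> norm_num)
  exact ⟨t, by simp only at e; linarith, ht.1, ht.2⟩

lemma units (v : Fin 3 → ℤ) (hN : |N v| = 1) : P v := by
  obtain ⟨t, ht, h1, h2⟩ := exists_t
  have ht0 : 0 < t := by linarith
  have hvec : ∀ w : Fin 3 → ℤ, w = ![w 0, w 1, w 2] := by
    intro w; ext i; fin_cases i <;> rfl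
  have hne : val t v ≠ 0 := by
    intro h0
    have hQ : ((N v : ℤ) : ℝ) = val t v *
      ((v 0 + t*v 1/2 + (1 - t^2/2)*v 2)^2 + (3*t^2/4 - 1)*(v 1 + v 2*t)^2) := by
      have t4 : t^4 = t^2 + t := by linear_combination t * ht
      have t5 : t^5 = t^2 + t + 1 := by linear_combination (t^2 + 1) * ht
      have t6 : t^6 = t^2 + 2*t + 1 := by linear_combination (t^3 + t + 1) * ht
      simp [N, val]; ring_nf
      simp only [ht, t4, t5, t6]; ring
    rw [h0, zero_mul] at hQ
    have : N v = 0 := by exact_mod_cast hQ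
    simp [this] at hN
  obtain ⟨n, hn1, hn2⟩ := exists_mem_Ico_zpow (abs_pos.2 hne) (show 1 < t by linarith)
  obtain ⟨w1, w2⟩ := zpow_vec t ht ht0 v (-n)
  set w := (U^(-n) : Matˣ).1.mulVec v with hw
  have hpos : 0 < t^n := zpow_pos ht0 n
  have hw1 : 1 ≤ |val t w| := by
    rw [w1, zpow_neg, inv_mul_eq_div, le_div_iff₀ hpos]; linarith
  have hw2 : |val t w| < t := by
    rw [w1, zpow_neg, inv_mul_eq_div, div_lt_iff₀ hpos]
    rw [zpow_add_one₀ ht0.ne'] at hn2; linarith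
  have hP : P w := by
    rw [hN] at w2
    have w3 := eq_or_eq_neg_of_abs_eq w2
    rw [hvec w] at hw1 hw2 w3 ⊢
    obtain ⟨b1, b2, b3⟩ := bounds t ht h1 h2 _ _ _ w3 hw1 hw2
    exact box_P _ _ _ b1 b2 b3 w3
  have := P_zpow hP n
  rw [hw, Matrix.mulVec_mulVec, ← Units.val_mul, ← zpow_add] at this
  simpa using this

/-! ### Zeros of the recurrence -/

def d : ℕ → ℤ
  | 0 => 0
  | 1 => 1
  | 2 => 0
  | (n+3) => d (n+2) - d n

lemma B3 : B^3 = B^2 - 1 := by decide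

lemma d_eq (m : ℕ) : (A^3 * B^m) 2 0 = d m := by
  induction m using Nat.strong_induction_on with
  | _ m ih =>
    match m, ih with
    | 0, _ => decide
    | 1, _ => decide
    | 2, _ => decide
    | (n+3), ih =>
      rw [d, ← ih (n+2) (by omega), ← ih n (by omega), pow_add, B3, pow_add B n 2]
      simp only [mul_sub, mul_one, Matrix.sub_apply]

lemma d_table : ∀ r < 58, d r % 59 = 0 → r = 0 ∨ r = 2 ∨ r = 3 ∨ r = 7 ∨ r = 16 := by
  decide +kernel

def al : Mat := !![-48, -13, 19; -19, -35, -32; 13, -19, -35]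

lemma B58 : B^58 = 1 + (59:ℤ) • al := by
  have h3 : B^3 = !![0, 1, 1; -1, -1, 0; -1, -1, -1] := by decide
  have h7 : B^7 = !![-1, -2, -2; 2, 1, 0; 2, 2, 1] := by
    rw [show 7 = 3 + 3 + 1 from rfl, pow_add, pow_add, h3]; decide
  have h14 : B^14 = !![-7, -4, 0; 0, -3, -4; 4, 0, -3] := by
    rw [show 14 = 7 + 7 from rfl, pow_add, h7]; decide
  have h29 : B^29 = !![33, 49, 40; -40, -16, 9; -49, -40, -16] := by
    rw [show 29 = 14 + 14 + 1 from rfl, pow_add, pow_add, h14]; decide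
  rw [show 58 = 29 + 29 from rfl, pow_add, h29]; decide

lemma pow_expand (q : ℤ) (g : Mat) (k : ℕ) : ∃ e : Mat,
    (1 + q • g)^k = 1 + ((k:ℤ) * q) • g + ((k.choose 2 : ℤ) * q^2) • (g * g) + q^3 • e := by
  induction k with
  | zero => exact ⟨0, by simp⟩
  | succ k ih =>
    obtain ⟨e, he⟩ := ih
    refine ⟨e + (k.choose 2 : ℤ) • (g * g * g) + q • (e * g), ?_⟩
    have hc : (((k+1).choose 2 : ℕ) : ℤ) = k + k.choose 2 := by
      rw [Nat.choose_succ_succ' k 1]; simp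
    rw [pow_succ, he, hc]
    simp only [mul_add, add_mul, mul_one, one_mul, smul_mul_assoc, mul_smul_comm, smul_smul]
    push_cast
    module

lemma tower (j : ℕ) : ∃ b : Mat,
    B^(58 * 59^j) = 1 + ((59:ℤ)^(j+1)) • (al + (59:ℤ) • b) := by
  induction j with
  | zero => exact ⟨0, by simpa using B58⟩
  | succ j ih =>
    obtain ⟨b, hb⟩ := ih
    obtain ⟨e, he⟩ := pow_expand ((59:ℤ)^(j+1)) (al + (59:ℤ) • b) 59
    set g := al + (59:ℤ) • b with hg
    refine ⟨b + ((29:ℤ) * 59^j) • (g * g) + ((59:ℤ)^(2*j)) • e, ?_⟩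
    rw [pow_succ 59 j, ← mul_assoc, pow_mul, hb, he, show Nat.choose 59 2 = 29 * 59 by decide]
    have hgal : al = g - (59:ℤ) • b := by rw [hg]; simp
    rw [hgal]
    generalize g * g = g2
    push_cast
    module

lemma d_unique (r : ℕ) (h0 : d r = 0) (h1 : ¬ (59^2 : ℤ) ∣ d (r + 58)) (k : ℕ)
    (hk : d (r + 58 * k) = 0) : k = 0 := by
  by_contra hk0
  obtain ⟨j, k', hk', rfl⟩ := Nat.exists_eq_pow_mul_and_not_dvd hk0 59 (by norm_num)
  obtain ⟨b, hb⟩ := tower j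
  obtain ⟨e, he⟩ := pow_expand ((59:ℤ)^(j+1)) (al + (59:ℤ) • b) k'
  set g := al + (59:ℤ) • b with hg
  rw [← d_eq, ← mul_assoc, pow_add, pow_mul, hb, he, ← mul_assoc] at hk
  rw [← d_eq] at h0
  rw [← d_eq, pow_add, B58, ← mul_assoc] at h1
  set C := A^3 * B^r with hC
  simp only [mul_add, mul_one, mul_smul_comm, Matrix.add_apply, Matrix.smul_apply, h0, zero_add,
    smul_eq_mul] at hk h1
  have hCg : (C * g) 2 0 = (C * al) 2 0 + 59 * (C * b) 2 0 := by
    rw [hg]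
    simp only [mul_add, mul_smul_comm, Matrix.add_apply, Matrix.smul_apply, smul_eq_mul]
  rw [hCg] at hk
  generalize (C * al) 2 0 = x at *
  generalize (C * b) 2 0 = y at *
  generalize (C * (g * g)) 2 0 = z at *
  generalize (C * e) 2 0 = w at *
  have hq : ((59:ℤ)^(j+1)) ≠ 0 := by positivity
  have h3 : (k':ℤ) * (x + 59 * y) + (k'.choose 2 : ℤ) * 59^(j+1) * z + (59^(j+1))^2 * w = 0 := by
    apply mul_left_cancel₀ hq
    linear_combination hk
  have h4 : (59:ℤ) ∣ k' * x := by
    refine ⟨-(k' * y + (k'.choose 2 : ℤ) * 59^j * z + 59^j * 59^(j+1) * w), ?_⟩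
    linear_combination h3
  have hp : Prime (59:ℤ) := by
    rw [Int.prime_iff_natAbs_prime]; norm_num
  rcases hp.dvd_or_dvd h4 with h | h
  · exact hk' (by exact_mod_cast h)
  · apply h1
    obtain ⟨u, rfl⟩ := h
    exact ⟨u, by ring⟩

lemma d_mod (r k : ℕ) : d (r + 58 * k) % 59 = d r % 59 := by
  obtain ⟨e, he⟩ := pow_expand 59 al k
  rw [← d_eq, ← d_eq, pow_add, pow_mul, B58, he, ← mul_assoc]
  simp only [mul_add, mul_one, mul_smul_comm, Matrix.add_apply, Matrix.smul_apply, smul_eq_mul]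
  set C := A^3 * B^r
  apply Int.ModEq.symm
  rw [Int.modEq_iff_dvd]
  refine ⟨k * (C * al) 2 0 + k.choose 2 * 59 * (C * (al * al)) 2 0 + 59^2 * (C * e) 2 0, ?_⟩
  ring

lemma d_zero (m : ℕ) (h : d m = 0) : m = 0 ∨ m = 2 ∨ m = 3 ∨ m = 7 ∨ m = 16 := by
  have hm : m = m % 58 + 58 * (m / 58) := (Nat.mod_add_div m 58).symm
  have hr : m % 58 < 58 := Nat.mod_lt _ (by norm_num)
  generalize m % 58 = r at *
  generalize m / 58 = k at *
  subst hm
  have ht := d_table r hr (by rw [← d_mod r k, h]; rfl)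
  have hz : d r = 0 := by
    rcases ht with rfl | rfl | rfl | rfl | rfl <;> decide +kernel
  have hn : ¬ (59^2 : ℤ) ∣ d (r + 58) := by
    rcases ht with rfl | rfl | rfl | rfl | rfl <;> decide +kernel
  have := d_unique r hz hn k h
  subst this
  simpa using ht

lemma pos_side (m : ℕ) : (A^(m+4)) 2 0 ≠ 0 := by
  have hA3 : A^3 = A - 1 := by decide
  have hrec : ∀ m, (A^(m+3)) 2 0 = (A^(m+1)) 2 0 - (A^m) 2 0 := by
    intro m
    rw [pow_add, hA3, pow_succ A m]
    simp only [mul_sub, mul_one, Matrix.sub_apply]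
  have h : ∀ m, 0 < (-1)^m * (A^(m+4)) 2 0 ∧ 0 < (-1)^(m+1) * (A^(m+1+4)) 2 0 ∧
      0 < (-1)^(m+2) * (A^(m+2+4)) 2 0 := by
    intro m
    induction m with
    | zero => decide
    | succ m ih =>
      obtain ⟨i1, i2, i3⟩ := ih
      refine ⟨i2, i3, ?_⟩
      have := hrec (m + 4)
      rw [show m + 1 + 2 + 4 = m + 4 + 3 by ring, this]
      rw [show m + 4 + 1 = m + 1 + 4 by ring]
      have e : (-1:ℤ)^(m+1+2) * ((A^(m+1+4)) 2 0 - (A^(m+4)) 2 0) =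
        (-1)^(m+1) * (A^(m+1+4)) 2 0 + (-1)^m * (A^(m+4)) 2 0 := by ring
      rw [e]; linarith
  intro h0
  have := (h m).1
  simp [h0] at this

lemma zeros (n : ℤ) (h : (U^n : Matˣ).1 2 0 = 0) :
    n = 3 ∨ n = 1 ∨ n = 0 ∨ n = -4 ∨ n = -13 := by
  rcases le_or_gt 4 n with hn | hn
  · obtain ⟨m, rfl⟩ := Int.le.dest hn
    exfalso
    apply pos_side m
    rw [add_comm, show ((m:ℤ) + 4) = ((m + 4 : ℕ) : ℤ) by push_cast; rfl, zpow_natCast,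
      Units.val_pow_eq_pow_val] at h
    exact h
  · obtain ⟨m, hm⟩ := Int.le.dest (show n ≤ 3 by omega)
    have hn : n = 3 + -(m:ℤ) := by omega
    have e : (U^n : Matˣ).1 = A^3 * B^m := by
      rw [hn, zpow_add, Units.val_mul, zpow_neg, ← inv_zpow, zpow_natCast,
        Units.val_pow_eq_pow_val]
      rfl
    rw [e, d_eq] at h
    have := d_zero m h
    omega

end Delone

open Delone in
theorem stmt12 (x y : ℤ) :
    x^3 - x*y^2 + y^3 = 1 ↔
      (x, y) = (1, 0) ∨ (x, y) = (0, 1) ∨ (x, y) = (1, 1) ∨ (x, y) = (-1, 1) ∨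
      (x, y) = (4, -3) := by
  constructor
  · intro h
    have hN : N ![x, -y, 0] = 1 := by simp [N]; linarith
    obtain ⟨n, hn⟩ := units ![x, -y, 0] (by rw [hN]; rfl)
    have hcol : ∀ i, ((U^n : Matˣ).1.mulVec e0) i = (U^n : Matˣ).1 i 0 := by
      intro i; simp [e0, Matrix.mulVec, dotProduct, Fin.sum_univ_three]
    have h2 : (U^n : Matˣ).1 2 0 = 0 := by
      rw [← hcol]
      rcases hn with hn | hn
      · rw [← hn]; rfl
      · have := congrFun hn 2
        rw [Pi.neg_apply] at this
        have h0 : (![x, -y, 0] : Fin 3 → ℤ) 2 = 0 := rfl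
        linarith
    have hx : (x = (U^n : Matˣ).1 0 0 ∧ -y = (U^n : Matˣ).1 1 0) ∨
        (x = -(U^n : Matˣ).1 0 0 ∧ -y = -(U^n : Matˣ).1 1 0) := by
      rcases hn with hn | hn
      · left; exact ⟨by rw [← hcol, ← hn]; rfl, by rw [← hcol, ← hn]; rfl⟩
      · right
        exact ⟨by rw [← hcol]; exact congrFun hn 0, by rw [← hcol]; exact congrFun hn 1⟩
    have hA3 : (U^(3:ℤ) : Matˣ).1 = !![-1, 0, -1; 1, -1, 1; 0, 1, -1] := by
      change A^3 = _
      decide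
    have B4 : B^4 = !![-1, 0, 1; -1, -1, -1; 0, -1, -1] := by decide
    have hB4 : (U^(-4:ℤ) : Matˣ).1 = !![-1, 0, 1; -1, -1, -1; 0, -1, -1] := B4
    have hB13 : (U^(-13:ℤ) : Matˣ).1 = !![-4, 0, 3; -3, -4, -3; 0, -3, -4] := by
      change B^13 = _
      rw [show 13 = 4 + 4 + 4 + 1 from rfl, pow_add, pow_add, pow_add, B4]; decide
    have hy : ∀ z : ℤ, -y = z → y = -z := fun z hz => by linarith
    rcases zeros n h2 with rfl | rfl | rfl | rfl | rfl
    · rw [hA3] at hx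
      rcases hx with ⟨rfl, hy'⟩ | ⟨rfl, hy'⟩ <;> obtain rfl := hy _ hy' <;> simp at h ⊢
    · rw [zpow_one] at hx
      change (x = A 0 0 ∧ -y = A 1 0) ∨ (x = -A 0 0 ∧ -y = -A 1 0) at hx
      rcases hx with ⟨rfl, hy'⟩ | ⟨rfl, hy'⟩ <;> obtain rfl := hy _ hy' <;> simp [A] at h ⊢
    · rw [zpow_zero] at hx
      rcases hx with ⟨rfl, hy'⟩ | ⟨rfl, hy'⟩ <;> obtain rfl := hy _ hy' <;> simp at h ⊢
    · rw [hB4] at hx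
      rcases hx with ⟨rfl, hy'⟩ | ⟨rfl, hy'⟩ <;> obtain rfl := hy _ hy' <;> simp at h ⊢
    · rw [hB13] at hx
      rcases hx with ⟨rfl, hy'⟩ | ⟨rfl, hy'⟩ <;> obtain rfl := hy _ hy' <;> simp at h ⊢
  · rintro (h | h | h | h | h) <;> (obtain ⟨rfl, rfl⟩ := Prod.mk.inj h; norm_num)
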